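/- Let Ω ⊂ ℝ^N (N ≥ 2) be a smooth bounded domain, assume (S1), (P1), (μ1) and (F1)–(F2), let q ∈ C₊(ℝ^N×ℝ^N) satisfy 2/q(x,y) + μ(x,y)/N = 2, and let α ∈ C₊(Ω̄) with α⁺ < p⁻. Then there exists Λ > 0 such that for every λ ∈ (0,Λ) there exist ζ_λ > 0 and δ_λ ∈ (0,1) with J_λ(u) ≥ ζ_λ for all u ∈ X₀ with ‖u‖_{X₀} = δ_λ. -/

import Mathlib

open MeasureTheory Set Filter ENNReal

noncomputable section

namespace VarOrderChoquard

variable {N : ℕ}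

/-- `ℝ^N` with the Euclidean structure. -/
abbrev RN (N : ℕ) := EuclideanSpace ℝ (Fin N)

/-- `Φ⁻` : infimum of a two-variable real function over `ℝ^N × ℝ^N`. -/
def inf2 (f : RN N → RN N → ℝ) : ℝ := sInf {t | ∃ x y, f x y = t}

/-- `Φ⁺` : supremum of a two-variable real function over `ℝ^N × ℝ^N`. -/
def sup2 (f : RN N → RN N → ℝ) : ℝ := sSup {t | ∃ x y, f x y = t}

/-- `Φ⁻` over a subset `D ⊆ ℝ^N`. -/
def infOn (D : Set (RN N)) (g : RN N → ℝ) : ℝ := sInf (g '' D)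

/-- `Φ⁺` over a subset `D ⊆ ℝ^N`. -/
def supOn (D : Set (RN N)) (g : RN N → ℝ) : ℝ := sSup (g '' D)

/-- `C₊(ℝ^N × ℝ^N)` : continuous with `1 < Φ⁻ ≤ Φ⁺ < ∞`. -/
def CPlus2 (f : RN N → RN N → ℝ) : Prop :=
  Continuous (fun z : RN N × RN N => f z.1 z.2) ∧ 1 < inf2 f ∧
    BddAbove {t | ∃ x y, f x y = t}

/-- `C₊(D)` for `D ⊆ ℝ^N`. -/
def CPlusOn (D : Set (RN N)) (g : RN N → ℝ) : Prop :=
  ContinuousOn g D ∧ 1 < infOn D g ∧ BddAbove (g '' D)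

/-- Condition (S1). -/
def S1 (s : RN N → RN N → ℝ) : Prop :=
  Continuous (fun z : RN N × RN N => s z.1 z.2) ∧ (∀ x y, s x y = s y x) ∧
    BddAbove {t | ∃ x y, s x y = t} ∧ 0 < inf2 s ∧ sup2 s < 1

/-- Condition (P1). -/
def P1 (s p : RN N → RN N → ℝ) : Prop :=
  CPlus2 p ∧ (∀ x y, p x y = p y x) ∧ sup2 s * sup2 p < N

/-- Condition (μ1). -/
def Mu1 (μ : RN N → RN N → ℝ) : Prop :=
  (∀ x y, μ x y = μ y x) ∧ BddAbove {t | ∃ x y, μ x y = t} ∧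
    0 < inf2 μ ∧ sup2 μ < N

/-- The critical exponent `p_s*(x) = N p(x,x) / (N - s(x,x) p(x,x))`. -/
def pstar (s p : RN N → RN N → ℝ) (x : RN N) : ℝ :=
  N * p x x / (N - s x x * p x x)

/-- The class `𝓜` : `p(x,x) ≤ r(x)q⁻ ≤ r(x)q⁺ < p_s*(x)` for all `x`. -/
def MemM (s p q : RN N → RN N → ℝ) (r : RN N → ℝ) : Prop :=
  ∀ x, p x x ≤ r x * inf2 q ∧ r x * inf2 q ≤ r x * sup2 q ∧
    r x * sup2 q < pstar s p x

/-- Variable-exponent modular `∫_U |u/l|^{γ(x)} dx`. -/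
def lmodular (U : Set (RN N)) (γ : RN N → ℝ) (u : RN N → ℝ) (l : ℝ) : ℝ≥0∞ :=
  ∫⁻ x in U, ENNReal.ofReal (|u x| / l) ^ γ x

/-- Membership in the variable-exponent Lebesgue space `L^{γ(x)}(U)`. -/
def MemVarLp (U : Set (RN N)) (γ : RN N → ℝ) (u : RN N → ℝ) : Prop :=
  Measurable u ∧ ∃ l, 0 < l ∧ lmodular U γ u l < ⊤

/-- Luxemburg norm on `L^{γ(x)}(U)`. -/
def luxNorm (U : Set (RN N)) (γ : RN N → ℝ) (u : RN N → ℝ) : ℝ :=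
  sInf {l | 0 < l ∧ lmodular U γ u l ≤ 1}

/-- Membership in the classical Lebesgue space `L^t(U)` (constant exponent `t`). -/
def MemCLp (U : Set (RN N)) (t : ℝ) (g : RN N → ℝ) : Prop :=
  Measurable g ∧ (∫⁻ x in U, ENNReal.ofReal |g x| ^ t) < ⊤

/-- The classical `L^t(U)`-norm. -/
def cLpNorm (U : Set (RN N)) (t : ℝ) (g : RN N → ℝ) : ℝ :=
  (∫⁻ x in U, ENNReal.ofReal |g x| ^ t).toReal ^ (1 / t)

/-- Gagliardo-type modular
`∫_A (|u(x)-u(y)|/l)^{p(x,y)} / |x-y|^{N+s(x,y)p(x,y)} dx dy`. -/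
def gmodular (A : Set (RN N × RN N)) (s p : RN N → RN N → ℝ) (u : RN N → ℝ)
    (l : ℝ) : ℝ≥0∞ :=
  ∫⁻ z in A, ENNReal.ofReal (|u z.1 - u z.2| / l) ^ p z.1 z.2 /
    ENNReal.ofReal (dist z.1 z.2) ^ ((N : ℝ) + s z.1 z.2 * p z.1 z.2)

/-- Membership in `W^{s(x,y),β(x),p(x,y)}(U)`. -/
def MemW (U : Set (RN N)) (s p : RN N → RN N → ℝ) (β : RN N → ℝ)
    (u : RN N → ℝ) : Prop :=
  MemVarLp U β u ∧ ∃ l, 0 < l ∧ gmodular (U ×ˢ U) s p u l < ⊤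

/-- The Gagliardo seminorm `[u]_U^{s,p}`. -/
def wSeminorm (U : Set (RN N)) (s p : RN N → RN N → ℝ) (u : RN N → ℝ) : ℝ :=
  sInf {l | 0 < l ∧ gmodular (U ×ˢ U) s p u l < 1}

/-- The norm on `W`. -/
def wNorm (U : Set (RN N)) (s p : RN N → RN N → ℝ) (β : RN N → ℝ)
    (u : RN N → ℝ) : ℝ :=
  luxNorm U β u + wSeminorm U s p u

/-- `Q = (ℝ^N × ℝ^N) \ (Ωᶜ × Ωᶜ)`. -/
def Qset (Ω : Set (RN N)) : Set (RN N × RN N) := univ \ (Ωᶜ ×ˢ Ωᶜ)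

/-- Membership in `X₀`. -/
def MemX0 (Ω : Set (RN N)) (s p : RN N → RN N → ℝ) (β : RN N → ℝ)
    (u : RN N → ℝ) : Prop :=
  Measurable u ∧ MemVarLp Ω β u ∧ (∃ l, 0 < l ∧ gmodular (Qset Ω) s p u l < ⊤) ∧
    (∀ᵐ x, x ∉ Ω → u x = 0)

/-- The `X₀`-norm. -/
def x0Norm (s p : RN N → RN N → ℝ) (u : RN N → ℝ) : ℝ :=
  sInf {l | 0 < l ∧ gmodular univ s p u l < 1}

/-- The modular `ρ_{X₀}`. -/
def rhoX0 (s p : RN N → RN N → ℝ) (u : RN N → ℝ) : ℝ≥0∞ :=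
  gmodular univ s p u 1

/-- Carathéodory function. -/
def Caratheodory (f : RN N → ℝ → ℝ) : Prop :=
  (∀ t, Measurable fun x => f x t) ∧ ∀ x, Continuous fun t => f x t

/-- `F(x,t) = ∫₀ᵗ f(x,τ) dτ`. -/
def Fant (f : RN N → ℝ → ℝ) (x : RN N) (t : ℝ) : ℝ := ∫ τ in (0:ℝ)..t, f x τ

/-- Growth condition (F1) (with data `M` and `r`). -/
def F1 (Ω : Set (RN N)) (f : RN N → ℝ → ℝ) (M : ℝ) (r : RN N → ℝ) : Prop :=
  0 < M ∧ ∀ x ∈ Ω, ∀ t : ℝ, |f x t| ≤ M * |t| ^ (r x - 1)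

/-- Ambrosetti–Rabinowitz type condition (F2) (with data `Θ`). -/
def F2 (Ω : Set (RN N)) (f : RN N → ℝ → ℝ) (Θ : ℝ) : Prop :=
  ∀ᵐ x, x ∈ Ω → ∀ t : ℝ, t ≠ 0 →
    0 < Θ * Fant f x t ∧ Θ * Fant f x t ≤ 2 * (t * f x t)

/-- The left-hand side pairing
`∫∫ |u(x)-u(y)|^{p-2}(u(x)-u(y))(w(x)-w(y)) / |x-y|^{N+sp} dx dy`. -/
def energyLHS (s p : RN N → RN N → ℝ) (u w : RN N → ℝ) : ℝ :=
  ∫ z : RN N × RN N,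
    |u z.1 - u z.2| ^ (p z.1 z.2 - 2) * (u z.1 - u z.2) * (w z.1 - w z.2) /
      dist z.1 z.2 ^ ((N : ℝ) + s z.1 z.2 * p z.1 z.2)

/-- The Choquard right-hand side `∫_Ω ∫_Ω F(x,u(x)) f(y,u(y)) w(y) / |x-y|^μ`. -/
def choquardRHS (Ω : Set (RN N)) (μ : RN N → RN N → ℝ) (f : RN N → ℝ → ℝ)
    (u w : RN N → ℝ) : ℝ :=
  ∫ x in Ω, ∫ y in Ω, Fant f x (u x) * f y (u y) * w y / dist x y ^ μ x y

/-- The energy functional `J`. -/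
def Jfun (Ω : Set (RN N)) (s p μ : RN N → RN N → ℝ) (f : RN N → ℝ → ℝ)
    (u : RN N → ℝ) : ℝ :=
  (∫ z : RN N × RN N,
    |u z.1 - u z.2| ^ p z.1 z.2 /
      (p z.1 z.2 * dist z.1 z.2 ^ ((N : ℝ) + s z.1 z.2 * p z.1 z.2)))
  - (1/2) * ∫ x in Ω, ∫ y in Ω,
      Fant f x (u x) * Fant f y (u y) / dist x y ^ μ x y

/-- `⟨J'(u), w⟩`. -/
def Jderiv (Ω : Set (RN N)) (s p μ : RN N → RN N → ℝ) (f : RN N → ℝ → ℝ)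
    (u w : RN N → ℝ) : ℝ :=
  energyLHS s p u w - choquardRHS Ω μ f u w

/-- The perturbed functional `J_λ`. -/
def Jlam (Ω : Set (RN N)) (s p μ : RN N → RN N → ℝ) (f : RN N → ℝ → ℝ)
    (α : RN N → ℝ) (lam : ℝ) (u : RN N → ℝ) : ℝ :=
  Jfun Ω s p μ f u - lam * ∫ x in Ω, |u x| ^ α x / α x


theorem measurable_gagliardo {s p : RN N → RN N → ℝ} {u : RN N → ℝ}
    (hs : Continuous fun z : RN N × RN N => s z.1 z.2)
    (hp : Continuous fun z : RN N × RN N => p z.1 z.2) (hu : Measurable u) (l : ℝ) :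
    Measurable fun z : RN N × RN N => ENNReal.ofReal (|u z.1 - u z.2| / l) ^ p z.1 z.2 /
      ENNReal.ofReal (dist z.1 z.2) ^ ((N : ℝ) + s z.1 z.2 * p z.1 z.2) := by
  have h1 := hs.measurable
  have h2 := hp.measurable
  have h3 : Measurable fun z : RN N × RN N => |u z.1 - u z.2| :=
    ((hu.comp measurable_fst).sub (hu.comp measurable_snd)).abs
  have h4 : Measurable fun z : RN N × RN N => dist z.1 z.2 := measurable_dist
  exact (((h3.div_const l).ennreal_ofReal).pow h2).div
    (h4.ennreal_ofReal.pow (measurable_const.add (h1.mul h2)))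

/-- A Chebyshev-type estimate for the Gagliardo modular. -/
theorem volume_mul_le_gmodular {s p : RN N → RN N → ℝ} {u : RN N → ℝ}
    (hs : Continuous fun z : RN N × RN N => s z.1 z.2)
    (hp : Continuous fun z : RN N × RN N => p z.1 z.2) (hu : Measurable u)
    {S : Set (RN N)} (hS : MeasurableSet S) {Y : RN N → Set (RN N)}
    (hY : ∀ x ∈ S, MeasurableSet (Y x)) {b c : ℝ≥0∞} (hb : ∀ x ∈ S, b ≤ volume (Y x))
    (hc : ∀ x ∈ S, ∀ y ∈ Y x, c ≤ ENNReal.ofReal (|u x - u y| / 1) ^ p x y /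
      ENNReal.ofReal (dist x y) ^ ((N : ℝ) + s x y * p x y)) :
    c * b * volume S ≤ gmodular univ s p u 1 := by
  unfold gmodular
  rw [Measure.restrict_univ, Measure.volume_eq_prod,
    lintegral_prod _ (measurable_gagliardo hs hp hu 1).aemeasurable]
  rw [← setLIntegral_const]
  refine (setLIntegral_mono' hS fun x hx => ?_).trans (setLIntegral_le_lintegral S _)
  refine le_trans ?_ (setLIntegral_le_lintegral (Y x) _)
  refine le_trans ?_ (setLIntegral_mono' (hY x hx) (hc x hx))
  rw [setLIntegral_const]
  gcongr
  exact hb x hx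

theorem ofReal_div_le_rpow_div {τ a p₁ P E d L : ℝ} (hτ : 1 ≤ τ) (ha : τ ≤ |a|)
    (hP0 : 0 ≤ P) (hP : p₁ ≤ P) (hd0 : 0 ≤ d) (hE0 : 0 ≤ E) (hL : 0 < L) (hd : d ^ E ≤ L) :
    ENNReal.ofReal (τ ^ p₁ / L) ≤
      ENNReal.ofReal (|a| / 1) ^ P / ENNReal.ofReal d ^ E := by
  rw [ENNReal.ofReal_div_of_pos hL, div_one, ENNReal.ofReal_rpow_of_nonneg (abs_nonneg a) hP0,
    ENNReal.ofReal_rpow_of_nonneg hd0 hE0]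
  refine ENNReal.div_le_div (ENNReal.ofReal_le_ofReal ?_) (ENNReal.ofReal_le_ofReal hd)
  exact (Real.rpow_le_rpow_of_exponent_le hτ hP).trans
    (Real.rpow_le_rpow (by linarith) ha hP0)

/-- From `k * m ≤ 1` one gets `m ≤ 1 / k`. -/
theorem le_ofReal_inv_of_mul_le_one {k : ℝ} (hk : 0 < k) {m : ℝ≥0∞}
    (h : ENNReal.ofReal k * m ≤ 1) : m ≤ ENNReal.ofReal k⁻¹ := by
  rw [ENNReal.ofReal_inv_of_pos hk, ← one_div, ENNReal.le_div_iff_mul_le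
    (Or.inl (by simpa using hk)) (Or.inl ENNReal.ofReal_ne_top), mul_comm]
  exact h

theorem volume_lt_abs_inter_le [NeZero N] {s p : RN N → RN N → ℝ} {Ω : Set (RN N)}
    (hs : Continuous fun z : RN N × RN N => s z.1 z.2)
    (hp : Continuous fun z : RN N × RN N => p z.1 z.2)
    (hs0 : ∀ x y, 0 < s x y) (hp1 : ∀ x y, 1 < p x y) (hsp : ∀ x y, s x y * p x y < N)
    (hΩo : IsOpen Ω) (hΩb : Bornology.IsBounded Ω) :
    ∃ C : ℝ, 0 < C ∧ ∀ u : RN N → ℝ, Measurable u → (∀ᵐ x, x ∉ Ω → u x = 0) →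
      gmodular univ s p u 1 ≤ 1 → ∀ t : ℝ, 1 ≤ t →
        volume ({x | t < |u x|} ∩ Ω) ≤ ENNReal.ofReal (C * t ^ (-1 : ℝ)) := by
  obtain ⟨R, hR1, hR⟩ : ∃ R : ℝ, 1 ≤ R ∧ Ω ⊆ Metric.ball 0 R := by
    obtain ⟨R, hR⟩ := hΩb.subset_ball (0 : RN N)
    exact ⟨max R 1, le_max_right _ _, hR.trans (Metric.ball_subset_ball (le_max_left _ _))⟩
  obtain ⟨z, hz⟩ := exists_norm_eq (RN N) (c := R + 1) (by linarith)
  set D : ℝ := (2 * R + 2) ^ (2 * (N : ℝ)) with hD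
  have hD0 : 0 < D := Real.rpow_pos_of_pos (by linarith) _
  set b : ℝ := (volume (Metric.ball z 1)).toReal with hb
  have hbv : volume (Metric.ball z 1) = ENNReal.ofReal b :=
    (ENNReal.ofReal_toReal measure_ball_lt_top.ne).symm
  have hb0 : 0 < b := ENNReal.toReal_pos (Metric.measure_ball_pos _ _ one_pos).ne'
    measure_ball_lt_top.ne
  refine ⟨D / b, by positivity, fun u hu hu0 hE t ht => ?_⟩
  have key := volume_mul_le_gmodular hs hp hu (S := {x | t < |u x|} ∩ Ω)
    ((measurableSet_lt measurable_const hu.abs).inter hΩo.measurableSet)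
    (Y := fun _ => Metric.ball z 1 ∩ {y | u y = 0})
    (fun _ _ => measurableSet_ball.inter (hu (measurableSet_singleton 0)))
    (b := ENNReal.ofReal b) (c := ENNReal.ofReal (t ^ (1 : ℝ) / D)) ?_ ?_
  · have h2 := key.trans hE
    rw [← ENNReal.ofReal_mul (by positivity)] at h2
    convert le_ofReal_inv_of_mul_le_one (by positivity) h2 using 2
    rw [Real.rpow_neg_one, Real.rpow_one]
    field_simp
  · intro x _
    rw [← hbv]
    refine measure_mono_ae ?_
    filter_upwards [hu0] with y hy hyb
    refine ⟨hyb, hy fun hyΩ => ?_⟩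
    have h1 := mem_ball_zero_iff.1 (hR hyΩ)
    have h2 : dist y z < 1 := hyb
    have h3 := norm_sub_norm_le z y
    rw [← dist_eq_norm, dist_comm] at h3
    linarith
  · rintro x ⟨hx, hxΩ⟩ y ⟨hy, hy0⟩
    have hy0 : u y = 0 := hy0
    have hx : t < |u x| := hx
    have hN : (0 : ℝ) ≤ N := Nat.cast_nonneg N
    have hsp0 : 0 < s x y * p x y := mul_pos (hs0 x y) (by linarith [hp1 x y])
    refine ofReal_div_le_rpow_div ht (by rw [hy0, sub_zero]; exact hx.le)
      (by linarith [hp1 x y]) (hp1 x y).le dist_nonneg (by linarith) hD0 ?_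
    have hd : dist x y ≤ 2 * R + 2 := by
      have h1 := mem_ball_zero_iff.1 (hR hxΩ)
      have h2 : dist y z < 1 := hy
      have h3 : dist x z ≤ ‖x‖ + ‖z‖ := by rw [dist_eq_norm]; exact norm_sub_le _ _
      have h4 := dist_triangle_right x y z
      linarith
    refine (Real.rpow_le_rpow dist_nonneg hd (by linarith)).trans ?_
    exact Real.rpow_le_rpow_of_exponent_le (by linarith) (by linarith [hsp x y])

/-- Uniform decay `C t^{-β}` near `x₀` of the distribution functions of all functions in the
unit ball of `X₀`. -/
def LevelDecay (Ω : Set (RN N)) (s p : RN N → RN N → ℝ) (x₀ : RN N) (β : ℝ) : Prop :=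
  ∃ ρ C T : ℝ, 0 < ρ ∧ 0 < C ∧ 1 ≤ T ∧ ∀ u : RN N → ℝ, Measurable u →
    (∀ᵐ x, x ∉ Ω → u x = 0) → gmodular univ s p u 1 ≤ 1 → ∀ t : ℝ, T ≤ t →
      volume ({x | t < |u x|} ∩ Metric.ball x₀ ρ) ≤ ENNReal.ofReal (C * t ^ (-β))

theorem LevelDecay.improve [NeZero N] {s p : RN N → RN N → ℝ} {Ω : Set (RN N)}
    (hs : Continuous fun z : RN N × RN N => s z.1 z.2)
    (hp : Continuous fun z : RN N × RN N => p z.1 z.2)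
    (hp1 : ∀ x y, 1 < p x y) {x₀ : RN N} {ρ₀ p₁ σ : ℝ} (hρ₀ : 0 < ρ₀) (hσ : 0 < σ)
    (hpl : ∀ x ∈ Metric.ball x₀ ρ₀, ∀ y ∈ Metric.ball x₀ ρ₀, p₁ ≤ p x y)
    (hsl : ∀ x ∈ Metric.ball x₀ ρ₀, ∀ y ∈ Metric.ball x₀ ρ₀, σ ≤ s x y * p x y)
    {β : ℝ} (hβ : 0 < β) (h : LevelDecay Ω s p x₀ β) :
    LevelDecay Ω s p x₀ (p₁ + σ / N * β) := by
  obtain ⟨ρ₁, C, T, hρ₁, hC, hT, H⟩ := h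
  set ρ := min (min ρ₁ ρ₀) 1 with hρdef
  have hρ : 0 < ρ := by positivity
  have hρρ₁ : ρ ≤ ρ₁ := (min_le_left _ _).trans (min_le_left _ _)
  have hρρ₀ : ρ ≤ ρ₀ := (min_le_left _ _).trans (min_le_right _ _)
  have hρ1 : ρ ≤ 1 := min_le_right _ _
  have hN0 : 0 < (N : ℝ) := Nat.cast_pos.2 (NeZero.pos N)
  set w : ℝ := (volume (Metric.ball (0 : RN N) 1)).toReal with hw
  have hw0 : 0 < w := ENNReal.toReal_pos (Metric.measure_ball_pos _ _ one_pos).ne'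
    measure_ball_lt_top.ne
  have hball : ∀ (x : RN N) (R : ℝ), 0 < R →
      volume (Metric.ball x R) = ENNReal.ofReal (R ^ N * w) := by
    intro x R hR
    rw [Measure.addHaar_ball_of_pos _ _ hR, finrank_euclideanSpace_fin,
      ENNReal.ofReal_mul (by positivity), hw, ENNReal.ofReal_toReal measure_ball_lt_top.ne]
  set A : ℝ := 1 + 2 * C / w with hA
  have hA1 : 1 ≤ A := by have : 0 < 2 * C / w := by positivity
                         linarith
  have hA0 : 0 < A := by linarith
  have hAN : 2 * C ≤ A ^ N * w := by
    have h1 : A ≤ A ^ N := le_self_pow₀ hA1 (NeZero.ne N)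
    have h2 : A * w = w + 2 * C := by rw [hA]; field_simp
    nlinarith
  have hlim : Tendsto (fun t : ℝ => A * t ^ (-(β / N))) atTop (nhds 0) := by
    simpa using (tendsto_rpow_neg_atTop (y := β / N) (by positivity)).const_mul A
  obtain ⟨T₁, hT₁⟩ := eventually_atTop.1 (hlim.eventually_le_const (half_pos hρ))
  set K : ℝ := C * A ^ (-((N : ℝ) + σ)) with hK
  have hK0 : 0 < K := by positivity
  set β' := p₁ + σ / N * β with hβ'
  refine ⟨ρ / 2, K⁻¹ * 2 ^ β', 2 * max T T₁, by positivity, by positivity, ?_, ?_⟩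
  · linarith [le_max_left T T₁]
  intro u hu hu0 hE t' ht'
  obtain ⟨t, rfl⟩ : ∃ t, t' = 2 * t := ⟨t' / 2, by ring⟩
  have htT : T ≤ t := by linarith [le_max_left T T₁]
  have ht1 : 1 ≤ t := hT.trans htT
  have ht0 : 0 < t := by linarith
  have hRρ : A * t ^ (-(β / N)) ≤ ρ / 2 := hT₁ t (by linarith [le_max_right T T₁])
  set R : ℝ := A * t ^ (-(β / N)) with hR
  have hR0 : 0 < R := by positivity
  have hRN : R ^ N = A ^ N * t ^ (-β) := by
    rw [hR, mul_pow, ← Real.rpow_natCast (t ^ _), ← Real.rpow_mul ht0.le]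
    congr 2
    field_simp
  have hlev : MeasurableSet {x | t < |u x|} := measurableSet_lt measurable_const hu.abs
  have key := volume_mul_le_gmodular hs hp hu (S := {x | 2 * t < |u x|} ∩ Metric.ball x₀ (ρ / 2))
    ((measurableSet_lt measurable_const hu.abs).inter measurableSet_ball)
    (Y := fun x => Metric.ball x R \ ({x | t < |u x|} ∩ Metric.ball x₀ ρ₁))
    (fun _ _ => measurableSet_ball.diff (hlev.inter measurableSet_ball))
    (b := ENNReal.ofReal (C * t ^ (-β))) (c := ENNReal.ofReal (t ^ p₁ / R ^ ((N : ℝ) + σ))) ?_ ?_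
  · have h2 := key.trans hE
    rw [← ENNReal.ofReal_mul (by positivity)] at h2
    refine (le_ofReal_inv_of_mul_le_one (by positivity) h2).trans_eq ?_
    congr 1
    have e1 : t ^ p₁ / R ^ ((N : ℝ) + σ) * (C * t ^ (-β)) = K * t ^ β' := by
      have e2 : R ^ ((N : ℝ) + σ) = A ^ ((N : ℝ) + σ) * t ^ (-β - σ / N * β) := by
        rw [hR, Real.mul_rpow hA0.le (by positivity), ← Real.rpow_mul ht0.le]
        congr 2
        field_simp
        ring
      rw [e2, hK, Real.rpow_neg hA0.le, div_mul_eq_mul_div, div_eq_iff (by positivity)]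
      have e3 : t ^ β' * t ^ (-β - σ / N * β) = t ^ p₁ * t ^ (-β) := by
        rw [← Real.rpow_add ht0, ← Real.rpow_add ht0, hβ']
        congr 1; ring
      have e4 : A ^ ((N : ℝ) + σ) ≠ 0 := by positivity
      calc t ^ p₁ * (C * t ^ (-β)) = C * (t ^ p₁ * t ^ (-β)) := by ring
        _ = C * (t ^ β' * t ^ (-β - σ / N * β)) := by rw [e3]
        _ = _ := by field_simp
    rw [e1, Real.mul_rpow (by norm_num) ht0.le, mul_inv, Real.rpow_neg ht0.le,
      Real.rpow_neg (by norm_num)]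
    field_simp
  · intro x _
    calc ENNReal.ofReal (C * t ^ (-β))
        ≤ ENNReal.ofReal (R ^ N * w) - ENNReal.ofReal (C * t ^ (-β)) := by
          rw [← ENNReal.ofReal_sub _ (by positivity)]
          refine ENNReal.ofReal_le_ofReal ?_
          rw [hRN]
          have : 0 < t ^ (-β) := by positivity
          nlinarith
      _ ≤ volume (Metric.ball x R) - volume ({x | t < |u x|} ∩ Metric.ball x₀ ρ₁) := by
          rw [hball x R hR0]
          exact tsub_le_tsub_left (H u hu hu0 hE t htT) _
      _ ≤ _ := le_measure_sdiff
  · rintro x ⟨hx, hxb⟩ y ⟨hyb, hyn⟩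
    have hx : 2 * t < |u x| := hx
    have hxb : dist x x₀ < ρ / 2 := hxb
    have hyb : dist y x < R := hyb
    have hy0 : dist y x₀ < ρ := by linarith [dist_triangle y x x₀]
    have hx0' : x ∈ Metric.ball x₀ ρ₀ := by rw [Metric.mem_ball]; linarith
    have hy0' : y ∈ Metric.ball x₀ ρ₀ := by rw [Metric.mem_ball]; linarith
    have huy : |u y| ≤ t := by
      by_contra hcon
      exact hyn ⟨not_le.1 hcon, by rw [Metric.mem_ball]; linarith⟩
    have hs' := hsl x hx0' y hy0'
    rw [dist_comm] at hyb
    refine ofReal_div_le_rpow_div ht1 ?_ (by linarith [hp1 x y]) (hpl x hx0' y hy0')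
      dist_nonneg (by linarith) (by positivity) ?_
    · linarith [abs_sub_abs_le_abs_sub (u x) (u y)]
    · refine (Real.rpow_le_rpow_of_exponent_ge_of_imp dist_nonneg (by linarith)
        (add_le_add_right hs' (N : ℝ)) ?_).trans
        (Real.rpow_le_rpow dist_nonneg hyb.le (by linarith))
      intro _ h0
      linarith

theorem levelDecay_one [NeZero N] {s p : RN N → RN N → ℝ} {Ω : Set (RN N)}
    (hs : Continuous fun z : RN N × RN N => s z.1 z.2)
    (hp : Continuous fun z : RN N × RN N => p z.1 z.2)
    (hs0 : ∀ x y, 0 < s x y) (hp1 : ∀ x y, 1 < p x y) (hsp : ∀ x y, s x y * p x y < N)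
    (hΩo : IsOpen Ω) (hΩb : Bornology.IsBounded Ω) (x₀ : RN N) :
    LevelDecay Ω s p x₀ 1 := by
  obtain ⟨C, hC, H⟩ := volume_lt_abs_inter_le hs hp hs0 hp1 hsp hΩo hΩb
  refine ⟨1, C, 1, one_pos, hC, le_rfl, fun u hu hu0 hE t ht => ?_⟩
  refine le_trans (measure_mono_ae ?_) (H u hu hu0 hE t ht)
  filter_upwards [hu0] with x hx hxt
  have hxt' : t < |u x| := hxt.1
  refine ⟨hxt', ?_⟩
  by_contra hxΩ
  rw [hx hxΩ, abs_zero] at hxt'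
  linarith

theorem exists_levelDecay_of_lt_pstar [NeZero N] {s p : RN N → RN N → ℝ} {Ω : Set (RN N)}
    (hs : Continuous fun z : RN N × RN N => s z.1 z.2)
    (hp : Continuous fun z : RN N × RN N => p z.1 z.2)
    (hs0 : ∀ x y, 0 < s x y) (hp1 : ∀ x y, 1 < p x y) (hsp : ∀ x y, s x y * p x y < N)
    (hΩo : IsOpen Ω) (hΩb : Bornology.IsBounded Ω) {x₀ : RN N} {b : ℝ}
    (hb : b < pstar s p x₀) : ∃ β, b < β ∧ LevelDecay Ω s p x₀ β := by
  have hN0 : 0 < (N : ℝ) := Nat.cast_pos.2 (NeZero.pos N)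
  have hsp0 : 0 < s x₀ x₀ * p x₀ x₀ := mul_pos (hs0 _ _) (by linarith [hp1 x₀ x₀])
  have hlt := hsp x₀ x₀
  obtain ⟨ε, hε, hεp, hεs, hεb⟩ : ∃ ε : ℝ, 0 < ε ∧ ε < p x₀ x₀ - 1 ∧ ε < s x₀ x₀ * p x₀ x₀ ∧
      b < N * (p x₀ x₀ - ε) / (N - (s x₀ x₀ * p x₀ x₀ - ε)) := by
    have hcont : ContinuousAt
        (fun ε : ℝ => N * (p x₀ x₀ - ε) / (N - (s x₀ x₀ * p x₀ x₀ - ε))) 0 := by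
      refine ContinuousAt.div (by fun_prop) (by fun_prop) ?_
      simp only [sub_zero]
      linarith
    have h1 : ∀ᶠ ε : ℝ in nhds 0, b < N * (p x₀ x₀ - ε) / (N - (s x₀ x₀ * p x₀ x₀ - ε)) :=
      hcont.eventually_const_lt (by simpa [pstar] using hb)
    have h2 : ∀ᶠ ε : ℝ in nhds 0, ε < p x₀ x₀ - 1 :=
      eventually_lt_nhds (by linarith [hp1 x₀ x₀])
    have h3 : ∀ᶠ ε : ℝ in nhds 0, ε < s x₀ x₀ * p x₀ x₀ := eventually_lt_nhds hsp0
    obtain ⟨ε, h, hε⟩ := (((h1.and (h2.and h3)).filter_mono nhdsWithin_le_nhds).and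
      (self_mem_nhdsWithin (a := (0 : ℝ)) (s := Ioi 0))).exists
    exact ⟨ε, hε, h.2.1, h.2.2, h.1⟩
  set p₁ := p x₀ x₀ - ε with hp₁
  set σ := s x₀ x₀ * p x₀ x₀ - ε with hσdef
  have hσ : 0 < σ := by linarith
  have hσN : σ < N := by linarith
  have hp₁1 : 1 < p₁ := by linarith
  obtain ⟨ρ₀, hρ₀, hloc⟩ : ∃ ρ₀ > 0, ∀ x ∈ Metric.ball x₀ ρ₀, ∀ y ∈ Metric.ball x₀ ρ₀,
      p₁ < p x y ∧ σ < s x y * p x y := by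
    have h1 : ∀ᶠ z : RN N × RN N in nhds (x₀, x₀), p₁ < p z.1 z.2 :=
      hp.continuousAt.eventually_const_lt (by simp [hp₁, hε])
    have h2 : ∀ᶠ z : RN N × RN N in nhds (x₀, x₀), σ < s z.1 z.2 * p z.1 z.2 :=
      (hs.mul hp).continuousAt.eventually_const_lt (by simp [hσdef, hε])
    obtain ⟨ρ₀, hρ₀, h⟩ := Metric.eventually_nhds_iff.1 (h1.and h2)
    refine ⟨ρ₀, hρ₀, fun x hx y hy => h (y := (x, y)) ?_⟩
    rw [Prod.dist_eq]
    exact max_lt hx hy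
  set θ := σ / N with hθ
  have hθ0 : 0 < θ := by positivity
  have hθ1 : θ < 1 := (div_lt_one hN0).2 hσN
  set L := N * p₁ / (N - σ) with hL
  have hL1 : 1 < L := by
    rw [hL, lt_div_iff₀ (by linarith)]
    nlinarith
  have hfix : p₁ + θ * L = L := by
    have : (N : ℝ) - σ ≠ 0 := by linarith
    rw [hL, hθ]
    field_simp
    ring
  have hdecay : ∀ j : ℕ, LevelDecay Ω s p x₀ (L - θ ^ j * (L - 1)) := by
    intro j
    induction j with
    | zero => simpa using levelDecay_one hs hp hs0 hp1 hsp hΩo hΩb x₀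
    | succ j ih =>
      have hle : θ ^ j ≤ 1 := pow_le_one₀ hθ0.le hθ1.le
      have h := ih.improve hs hp hp1 hρ₀ hσ (fun x hx y hy => (hloc x hx y hy).1.le)
        (fun x hx y hy => (hloc x hx y hy).2.le) (by nlinarith)
      convert h using 1
      rw [pow_succ]
      linear_combination -hfix
  have hlim : Tendsto (fun j : ℕ => L - θ ^ j * (L - 1)) atTop (nhds L) := by
    simpa using ((tendsto_pow_atTop_nhds_zero_of_lt_one hθ0.le hθ1).mul_const
      (L - 1)).const_sub L
  obtain ⟨j, hj⟩ := (hlim.eventually_const_lt hεb).exists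
  exact ⟨_, hj, hdecay j⟩

theorem setLIntegral_ofReal_rpow_lt_top_of_decay {ν : ℝ → ℝ≥0∞} {V : ℝ≥0∞} (hV : V ≠ ⊤)
    {β g C T : ℝ} (hg : 0 < g) (hgβ : g < β) (hT : 0 < T)
    (hν : ∀ t, ν t = min V (if T < t then ENNReal.ofReal (C * t ^ (-β)) else ⊤)) :
    ∫⁻ t in Ioi (0 : ℝ), ν t * ENNReal.ofReal (t ^ (g - 1)) ≠ ⊤ := by
  rw [← Ioc_union_Ioi_eq_Ioi hT.le]
  refine ((lintegral_union_le _ _ _).trans_lt (ENNReal.add_lt_top.2 ⟨?_, ?_⟩)).ne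
  · calc ∫⁻ t in Ioc 0 T, ν t * ENNReal.ofReal (t ^ (g - 1))
        ≤ ∫⁻ t in Ioc 0 T, V * ENNReal.ofReal (t ^ (g - 1)) := by
          refine lintegral_mono fun t => ?_
          gcongr
          rw [hν]; exact min_le_left _ _
      _ = V * ∫⁻ t in Ioc 0 T, ENNReal.ofReal (t ^ (g - 1)) :=
          lintegral_const_mul' _ _ hV
      _ < ⊤ := by
          refine ENNReal.mul_lt_top hV.lt_top ?_
          have h := (intervalIntegral.intervalIntegrable_rpow' (a := 0) (b := T)
            (r := g - 1) (by linarith)).1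
          exact (hasFiniteIntegral_iff_ofReal (by
            filter_upwards [ae_restrict_mem measurableSet_Ioc] with t ht
            exact Real.rpow_nonneg ht.1.le _)).1 h.2
  · calc ∫⁻ t in Ioi T, ν t * ENNReal.ofReal (t ^ (g - 1))
        ≤ ∫⁻ t in Ioi T, ENNReal.ofReal C * ENNReal.ofReal (t ^ (g - 1 - β)) := by
          refine setLIntegral_mono' measurableSet_Ioi fun t ht => ?_
          have ht' : T < t := ht
          have ht0 : 0 < t := hT.trans ht
          have h1 : ν t ≤ ENNReal.ofReal (C * t ^ (-β)) := by
            rw [hν, if_pos ht']; exact min_le_right _ _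
          refine (mul_le_mul_left h1 _).trans_eq ?_
          rw [← ENNReal.ofReal_mul' (by positivity), ← ENNReal.ofReal_mul' (by positivity),
            mul_assoc, ← Real.rpow_add ht0]
          congr 3; ring
      _ = ENNReal.ofReal C * ∫⁻ t in Ioi T, ENNReal.ofReal (t ^ (g - 1 - β)) :=
          lintegral_const_mul' _ _ ENNReal.ofReal_ne_top
      _ < ⊤ := by
          refine ENNReal.mul_lt_top ENNReal.ofReal_lt_top ?_
          have h := integrableOn_Ioi_rpow_of_lt (a := g - 1 - β) (by linarith) hT
          exact (hasFiniteIntegral_iff_ofReal (by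
            filter_upwards [ae_restrict_mem measurableSet_Ioi] with t ht
            exact Real.rpow_nonneg (hT.trans ht).le _)).1 h.2

theorem LevelDecay.exists_lintegral_le {s p : RN N → RN N → ℝ} {Ω : Set (RN N)}
    {x₀ : RN N} {β : ℝ} (h : LevelDecay Ω s p x₀ β) {γ : RN N → ℝ} (hγ : Continuous γ)
    (hγ0 : ∀ x, 0 < γ x) (hγβ : γ x₀ < β) :
    ∃ ρ > 0, ∃ C : ℝ≥0∞, C ≠ ⊤ ∧ ∀ u : RN N → ℝ, Measurable u →
      (∀ᵐ x, x ∉ Ω → u x = 0) → gmodular univ s p u 1 ≤ 1 →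
        ∫⁻ x in Metric.ball x₀ ρ, ENNReal.ofReal |u x| ^ γ x ≤ C := by
  obtain ⟨ρ₁, C, T, hρ₁, hC, hT, H⟩ := h
  obtain ⟨g, hg1, hg2⟩ := exists_between hγβ
  have hg0 : 0 < g := (hγ0 x₀).trans hg1
  obtain ⟨ρ₂, hρ₂, hloc⟩ := Metric.eventually_nhds_iff.1
    (hγ.continuousAt.eventually_lt_const hg1)
  set ρ := min ρ₁ ρ₂ with hρ
  have hρ0 : 0 < ρ := lt_min hρ₁ hρ₂
  set V := volume (Metric.ball x₀ ρ) with hV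
  have hVt : V ≠ ⊤ := measure_ball_lt_top.ne
  set ν : ℝ → ℝ≥0∞ :=
    fun t => min V (if T < t then ENNReal.ofReal (C * t ^ (-β)) else ⊤) with hν
  refine ⟨ρ, hρ0, V + ENNReal.ofReal g *
      ∫⁻ t in Ioi (0 : ℝ), ν t * ENNReal.ofReal (t ^ (g - 1)), ?_, ?_⟩
  · exact ENNReal.add_ne_top.2 ⟨hVt, ENNReal.mul_ne_top ENNReal.ofReal_ne_top
      (setLIntegral_ofReal_rpow_lt_top_of_decay hVt hg0 hg2 (by linarith) fun _ => rfl)⟩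
  intro u hu hu0 hE
  calc ∫⁻ x in Metric.ball x₀ ρ, ENNReal.ofReal |u x| ^ γ x
      ≤ ∫⁻ x in Metric.ball x₀ ρ, (1 + ENNReal.ofReal (|u x| ^ g)) := by
        refine setLIntegral_mono' measurableSet_ball fun x hx => ?_
        have hxg : γ x < g := hloc (lt_of_lt_of_le hx (min_le_right _ _))
        rcases le_total (ENNReal.ofReal |u x|) 1 with h1 | h1
        · exact (ENNReal.rpow_le_one h1 (hγ0 x).le).trans le_self_add
        · rw [← ENNReal.ofReal_rpow_of_nonneg (abs_nonneg _) hg0.le]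
          exact (ENNReal.rpow_le_rpow_of_exponent_le h1 hxg.le).trans le_add_self
    _ = V + ∫⁻ x in Metric.ball x₀ ρ, ENNReal.ofReal (|u x| ^ g) := by
        rw [lintegral_add_left measurable_const, setLIntegral_one]
    _ ≤ _ := by
        rw [lintegral_rpow_eq_lintegral_meas_lt_mul (volume.restrict (Metric.ball x₀ ρ))
          (Eventually.of_forall fun x => abs_nonneg (u x)) hu.abs.aemeasurable hg0]
        gcongr with t
        rw [Measure.restrict_apply (measurableSet_lt measurable_const hu.abs)]
        refine le_min (measure_mono inter_subset_right) ?_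
        split_ifs with htT
        · refine le_trans (measure_mono ?_) (H u hu hu0 hE t htT.le)
          gcongr
          exact min_le_left _ _
        · exact le_top

/-- Boundedness of the subcritical embedding of the unit ball of `X₀`, in terms of modulars. -/
theorem exists_lintegral_rpow_le [NeZero N] {s p : RN N → RN N → ℝ} {Ω : Set (RN N)}
    (hs : Continuous fun z : RN N × RN N => s z.1 z.2)
    (hp : Continuous fun z : RN N × RN N => p z.1 z.2)
    (hs0 : ∀ x y, 0 < s x y) (hp1 : ∀ x y, 1 < p x y) (hsp : ∀ x y, s x y * p x y < N)
    (hΩo : IsOpen Ω) (hΩb : Bornology.IsBounded Ω) {γ : RN N → ℝ} (hγ : Continuous γ)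
    (hγ0 : ∀ x, 0 < γ x) (hγp : ∀ x ∈ closure Ω, γ x < pstar s p x) :
    ∃ C : ℝ≥0∞, C ≠ ⊤ ∧ ∀ u : RN N → ℝ, Measurable u →
      (∀ᵐ x, x ∉ Ω → u x = 0) → gmodular univ s p u 1 ≤ 1 →
        ∫⁻ x in Ω, ENNReal.ofReal |u x| ^ γ x ≤ C := by
  suffices h : ∃ C : ℝ≥0∞, C ≠ ⊤ ∧ ∀ u : RN N → ℝ, Measurable u →
      (∀ᵐ x, x ∉ Ω → u x = 0) → gmodular univ s p u 1 ≤ 1 →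
        ∫⁻ x in closure Ω, ENNReal.ofReal |u x| ^ γ x ≤ C by
    obtain ⟨C, hC, H⟩ := h
    exact ⟨C, hC, fun u hu hu0 hE =>
      (lintegral_mono_set subset_closure).trans (H u hu hu0 hE)⟩
  refine hΩb.isCompact_closure.induction_on (p := fun S => ∃ C : ℝ≥0∞, C ≠ ⊤ ∧
    ∀ u : RN N → ℝ, Measurable u → (∀ᵐ x, x ∉ Ω → u x = 0) → gmodular univ s p u 1 ≤ 1 →
        ∫⁻ x in S, ENNReal.ofReal |u x| ^ γ x ≤ C) ⟨0, by simp, by simp⟩ ?_ ?_ ?_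
  · rintro S S' hSS ⟨C, hC, H⟩
    exact ⟨C, hC, fun u hu hu0 hE => (lintegral_mono_set hSS).trans (H u hu hu0 hE)⟩
  · rintro S S' ⟨C, hC, H⟩ ⟨C', hC', H'⟩
    exact ⟨C + C', ENNReal.add_ne_top.2 ⟨hC, hC'⟩, fun u hu hu0 hE =>
      (lintegral_union_le _ _ _).trans (add_le_add (H u hu hu0 hE) (H' u hu hu0 hE))⟩
  · intro x hx
    obtain ⟨β, hβ, hdec⟩ :=
      exists_levelDecay_of_lt_pstar hs hp hs0 hp1 hsp hΩo hΩb (hγp x hx)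
    obtain ⟨ρ, hρ, C, hC, H⟩ := hdec.exists_lintegral_le hγ hγ0 hβ
    exact ⟨Metric.ball x ρ, mem_nhdsWithin_of_mem_nhds (Metric.ball_mem_nhds x hρ), C, hC, H⟩

theorem exists_lintegral_dist_rpow_neg_le [NeZero N] {Ω : Set (RN N)}
    (hΩb : Bornology.IsBounded Ω) {κ : ℝ} (hκ : κ < N) :
    ∃ C : ℝ≥0∞, C ≠ ⊤ ∧ ∀ x ∈ Ω, ∫⁻ y in Ω, ENNReal.ofReal (dist x y ^ (-κ)) ≤ C := by
  obtain ⟨R, hR⟩ := hΩb.subset_ball (0 : RN N)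
  have hint : IntegrableOn (fun x : RN N => ‖x‖ ^ (-κ)) (Metric.ball 0 (2 * R)) volume := by
    rw [integrableOn_fun_norm_addHaar volume (f := fun y : ℝ => y ^ (-κ)),
      finrank_euclideanSpace_fin]
    have h1 := (intervalIntegral.intervalIntegrable_rpow' (a := 0) (b := 2 * R)
      (r := (N : ℝ) - 1 - κ) (by linarith)).1
    refine (h1.mono_set Ioo_subset_Ioc_self).congr_fun (fun y hy => ?_) measurableSet_Ioo
    simp only [smul_eq_mul]
    rw [← Real.rpow_natCast, ← Real.rpow_add hy.1, Nat.cast_sub (NeZero.one_le), Nat.cast_one]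
    rfl
  have hfin := (hasFiniteIntegral_iff_ofReal
    (Eventually.of_forall fun x : RN N => Real.rpow_nonneg (norm_nonneg x) (-κ))).1 hint.2
  refine ⟨_, hfin.ne, fun x hx => ?_⟩
  rw [← lintegral_indicator measurableSet_ball,
    ← lintegral_sub_left_eq_self (μ := volume) (indicator _ _) x]
  refine le_trans (lintegral_mono_ae ?_) (setLIntegral_le_lintegral Ω _)
  have hae : ∀ᵐ y ∂(volume.restrict Ω), y ∈ Metric.ball (0 : RN N) R :=
    (ae_mono (Measure.restrict_mono hR le_rfl)) (ae_restrict_mem measurableSet_ball)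
  filter_upwards [hae] with y hy
  rw [indicator_of_mem, ← dist_eq_norm]
  have h1 := mem_ball_zero_iff.1 (hR hx)
  have h2 := mem_ball_zero_iff.1 hy
  rw [mem_ball_zero_iff]
  linarith [norm_sub_le x y]

theorem mul_mul_le_rpow_add {a t G H K : ℝ} (ha1 : 1 < a) (ha2 : a ≤ 2)
    (ht : 1 / t = 2 - 2 / a) (hG : 0 ≤ G) (hH : 0 ≤ H) (hK : 0 ≤ K) :
    G * H * K ≤ G ^ a * H ^ a + G ^ a * K ^ t + H ^ a * K ^ t := by
  have ha0 : 0 < a := by linarith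
  have h2a : 2 / a < 2 := by rw [div_lt_iff₀ ha0]; linarith
  have h2a' : 1 ≤ 2 / a := by rw [le_div_iff₀ ha0]; linarith
  have haa : 1 / a = 2 / a / 2 := by ring
  have ht0 : 0 < t := by
    rw [← one_div_pos, ht]; linarith
  have key := Real.geom_mean_le_arith_mean3_weighted (w₁ := 1 - 1 / t) (w₂ := 1 - 1 / a)
    (w₃ := 1 - 1 / a) (p₁ := G ^ a * H ^ a) (p₂ := G ^ a * K ^ t) (p₃ := H ^ a * K ^ t)
    (by linarith) (by linarith) (by linarith) (by positivity) (by positivity) (by positivity)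
    (by rw [ht]; ring)
  have hpow : ∀ {x : ℝ} (e w w' : ℝ), 0 ≤ x → e * w + e * w' = 1 →
      (x ^ e) ^ w * (x ^ e) ^ w' = x := by
    intro x e w w' hx he
    rw [← Real.rpow_mul hx, ← Real.rpow_mul hx, ← Real.rpow_add' hx (by rw [he]; norm_num), he,
      Real.rpow_one]
  have hat : a * (1 - 1 / t) + a * (1 - 1 / a) = 1 := by
    rw [ht]; field_simp; ring
  have htt : t * (1 - 1 / a) + t * (1 - 1 / a) = 1 := by
    have : 1 - 1 / a = 1 / t / 2 := by rw [ht]; ring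
    rw [this]; field_simp; norm_num
  have hlhs : (G ^ a * H ^ a) ^ (1 - 1 / t) * (G ^ a * K ^ t) ^ (1 - 1 / a) *
      (H ^ a * K ^ t) ^ (1 - 1 / a) = G * H * K := by
    rw [Real.mul_rpow (by positivity) (by positivity), Real.mul_rpow (by positivity)
      (by positivity), Real.mul_rpow (by positivity) (by positivity)]
    calc _ = ((G ^ a) ^ (1 - 1 / t) * (G ^ a) ^ (1 - 1 / a)) *
          ((H ^ a) ^ (1 - 1 / t) * (H ^ a) ^ (1 - 1 / a)) *
          ((K ^ t) ^ (1 - 1 / a) * (K ^ t) ^ (1 - 1 / a)) := by ring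
      _ = G * H * K := by rw [hpow a _ _ hG hat, hpow a _ _ hH hat, hpow t _ _ hK htt]
  rw [hlhs] at key
  have hinv : 0 < 1 / t := by positivity
  have hinva : 0 < 1 / a := by positivity
  refine key.trans (add_le_add (add_le_add ?_ ?_) ?_) <;>
    exact mul_le_of_le_one_left (by positivity) (by linarith)

theorem lintegral_lintegral_schur_le {Ω : Set (RN N)} (hΩo : IsOpen Ω) {A : RN N → ℝ≥0∞}
    {κ : RN N → RN N → ℝ≥0∞} (hA : Measurable A) (hκ : Measurable (Function.uncurry κ))
    (hsymm : ∀ x y, κ x y = κ y x) {C k : ℝ≥0∞} (hC : ∫⁻ x in Ω, A x ≤ C)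
    (hk : ∀ x ∈ Ω, ∫⁻ y in Ω, κ x y ≤ k) :
    ∫⁻ x in Ω, ∫⁻ y in Ω, (A x * A y + A x * κ x y + A y * κ x y) ≤ C * C + C * k + C * k := by
  have hκx : ∀ x, Measurable (κ x) := fun x => hκ.comp measurable_prodMk_left
  have hAκ : Measurable fun z : RN N × RN N => A z.2 * κ z.1 z.2 :=
    (hA.comp measurable_snd).mul hκ
  calc ∫⁻ x in Ω, ∫⁻ y in Ω, (A x * A y + A x * κ x y + A y * κ x y)
      = ∫⁻ x in Ω, (A x * (∫⁻ y in Ω, A y) + A x * (∫⁻ y in Ω, κ x y) +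
          ∫⁻ y in Ω, A y * κ x y) := by
        refine lintegral_congr fun x => ?_
        rw [lintegral_add_left (f := fun y => A x * A y + A x * κ x y)
            ((hA.const_mul _).add ((hκx x).const_mul _)),
          lintegral_add_left (hA.const_mul _), lintegral_const_mul _ hA,
          lintegral_const_mul _ (hκx x)]
    _ ≤ ∫⁻ x in Ω, (A x * C + A x * k + ∫⁻ y in Ω, A y * κ x y) := by
        refine setLIntegral_mono' hΩo.measurableSet fun x hx => ?_
        gcongr
        exact hk x hx
    _ = (∫⁻ x in Ω, A x) * C + (∫⁻ x in Ω, A x) * k +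
          ∫⁻ y in Ω, ∫⁻ x in Ω, A y * κ x y := by
        rw [lintegral_add_left (f := fun x => A x * C + A x * k)
            ((hA.mul_const _).add (hA.mul_const _)),
          lintegral_add_left (hA.mul_const _), lintegral_mul_const _ hA,
          lintegral_mul_const _ hA, lintegral_lintegral_swap hAκ.aemeasurable]
    _ ≤ C * C + C * k + ∫⁻ y in Ω, A y * k := by
        gcongr ?_ * _ + ?_ * _ + ?_
        refine setLIntegral_mono' hΩo.measurableSet fun y hy => ?_
        simp_rw [hsymm _ y]
        rw [lintegral_const_mul _ (hκx y)]
        gcongr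
        exact hk y hy
    _ ≤ C * C + C * k + C * k := by
        rw [lintegral_mul_const _ hA]
        gcongr

theorem inv_dist_rpow_le {d D m k : ℝ} (hd0 : 0 ≤ d) (hdD : d ≤ D) (hD1 : 1 ≤ D) (hk0 : 0 < k)
    (hkm : k ≤ m) : (d ^ k)⁻¹ ≤ D ^ m * d ^ (-m) := by
  have hD0 : 0 < D := by linarith
  rcases hd0.eq_or_lt with h0 | h0
  · rw [← h0, Real.zero_rpow hk0.ne', _root_.inv_zero]
    positivity
  · rw [Real.rpow_neg h0.le, ← div_eq_mul_inv, ← Real.div_rpow hD0.le h0.le, ← Real.inv_rpow h0.le]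
    have h1 : 1 ≤ D / d := (one_le_div h0).2 hdD
    refine le_trans ?_ (Real.rpow_le_rpow_of_exponent_le h1 hkm)
    refine Real.rpow_le_rpow (by positivity) ?_ hk0.le
    rw [inv_eq_one_div]
    gcongr

theorem enorm_mul_div_rpow_le {d D m k a t c G H φ ψ : ℝ} (hd0 : 0 ≤ d) (hdD : d ≤ D)
    (hD1 : 1 ≤ D) (hk0 : 0 < k) (hkm : k ≤ m) (ha1 : 1 < a) (ha2 : a ≤ 2)
    (ht : 1 / t = 2 - 2 / a) (hc : 0 ≤ c) (hG : 0 ≤ G) (hH : 0 ≤ H) (hφ : |φ| ≤ c * G)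
    (hψ : |ψ| ≤ c * H) :
    ‖φ * ψ / d ^ k‖ₑ ≤ ENNReal.ofReal (c ^ 2 * D ^ m) *
      (ENNReal.ofReal (G ^ a) * ENNReal.ofReal (H ^ a) +
        ENNReal.ofReal (G ^ a) * ENNReal.ofReal (d ^ (-(m * t))) +
        ENNReal.ofReal (H ^ a) * ENNReal.ofReal (d ^ (-(m * t)))) := by
  have hD0 : 0 < D := by linarith
  rw [← ENNReal.ofReal_mul (by positivity), ← ENNReal.ofReal_mul (by positivity),
    ← ENNReal.ofReal_mul (by positivity), ← ENNReal.ofReal_add (by positivity) (by positivity),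
    ← ENNReal.ofReal_add (by positivity) (by positivity), ← ENNReal.ofReal_mul (by positivity),
    Real.enorm_eq_ofReal_abs]
  refine ENNReal.ofReal_le_ofReal ?_
  have hY := mul_mul_le_rpow_add ha1 ha2 ht hG hH (Real.rpow_nonneg hd0 (-m))
  rw [← Real.rpow_mul hd0, neg_mul] at hY
  rw [abs_div, abs_mul, abs_of_nonneg (Real.rpow_nonneg hd0 k), div_eq_mul_inv]
  calc |φ| * |ψ| * (d ^ k)⁻¹ ≤ (c * G) * (c * H) * (D ^ m * d ^ (-m)) := by
        have := inv_dist_rpow_le hd0 hdD hD1 hk0 hkm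
        gcongr
    _ = c ^ 2 * D ^ m * (G * H * d ^ (-m)) := by ring
    _ ≤ _ := by gcongr

/-- A subcritical Hardy–Littlewood–Sobolev inequality with variable order on a bounded set. -/
theorem exists_abs_integral_integral_le [NeZero N] {Ω : Set (RN N)} (hΩo : IsOpen Ω)
    (hΩb : Bornology.IsBounded Ω) {a m : ℝ} (ha1 : 1 < a) (ha2 : a ≤ 2)
    (hm : m < N * (2 - 2 / a)) {C : ℝ≥0∞} (hC : C ≠ ⊤) :
    ∃ B : ℝ, 0 ≤ B ∧ ∀ μ : RN N → RN N → ℝ, (∀ x y, 0 < μ x y) → (∀ x y, μ x y ≤ m) →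
      ∀ (Φ g : RN N → ℝ) (c : ℝ), Measurable g → (∀ x, 0 ≤ g x) → 0 ≤ c →
        (∀ x ∈ Ω, |Φ x| ≤ c * g x) → ∫⁻ x in Ω, ENNReal.ofReal (g x ^ a) ≤ C →
          |∫ x in Ω, ∫ y in Ω, Φ x * Φ y / dist x y ^ μ x y| ≤ B * c ^ 2 := by
  have ha0 : 0 < a := by linarith
  have hpos : 0 < 2 - 2 / a := by
    have : 2 / a < 2 := by rw [div_lt_iff₀ ha0]; linarith
    linarith
  obtain ⟨t, ht⟩ : ∃ t : ℝ, t = 1 / (2 - 2 / a) := ⟨_, rfl⟩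
  have ht1 : 1 / t = 2 - 2 / a := by rw [ht, one_div_one_div]
  have hmt : m * t < N := by rw [ht, mul_one_div, div_lt_iff₀ hpos]; exact hm
  obtain ⟨k, hk, hkb⟩ := exists_lintegral_dist_rpow_neg_le hΩb hmt
  obtain ⟨D, hD1, hD⟩ : ∃ D : ℝ, 1 ≤ D ∧ ∀ x ∈ Ω, ∀ y ∈ Ω, dist x y ≤ D := by
    obtain ⟨D, hD⟩ := Metric.isBounded_iff.1 hΩb
    exact ⟨max D 1, le_max_right _ _, fun x hx y hy => (hD hx hy).trans (le_max_left _ _)⟩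
  have hD0 : 0 < D := by linarith
  have hEt : C * C + C * k + C * k ≠ ⊤ := by
    simp [ENNReal.add_eq_top, ENNReal.mul_eq_top, hC, hk]
  refine ⟨D ^ m * (C * C + C * k + C * k).toReal, by positivity,
    fun μ hμ0 hμm Φ g c hg hg0 hc hΦ hgC => ?_⟩
  have hker : Measurable fun z : RN N × RN N => ENNReal.ofReal (dist z.1 z.2 ^ (-(m * t))) :=
    (measurable_dist.pow_const _).ennreal_ofReal
  have hschur := lintegral_lintegral_schur_le hΩo (hg.pow_const a).ennreal_ofReal
    (κ := fun x y => ENNReal.ofReal (dist x y ^ (-(m * t)))) hker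
    (fun x y => by rw [dist_comm]) hgC hkb
  have hint : ‖∫ x in Ω, ∫ y in Ω, Φ x * Φ y / dist x y ^ μ x y‖ₑ ≤
      ENNReal.ofReal (c ^ 2 * D ^ m) * (C * C + C * k + C * k) := by
    refine le_trans ?_ (mul_le_mul_right hschur _)
    rw [← lintegral_const_mul' _ _ ENNReal.ofReal_ne_top]
    simp_rw [← lintegral_const_mul' _ _ ENNReal.ofReal_ne_top]
    refine (enorm_integral_le_lintegral_enorm _).trans ?_
    refine setLIntegral_mono' hΩo.measurableSet fun x hx => ?_
    refine (enorm_integral_le_lintegral_enorm _).trans ?_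
    exact setLIntegral_mono' hΩo.measurableSet fun y hy =>
      enorm_mul_div_rpow_le dist_nonneg (hD x hx y hy) hD1 (hμ0 x y) (hμm x y) ha1 ha2 ht1 hc
        (hg0 x) (hg0 y) (hΦ x hx) (hΦ y hy)
  rw [Real.enorm_eq_ofReal_abs, ← ENNReal.ofReal_toReal hEt,
    ← ENNReal.ofReal_mul (by positivity)] at hint
  have h := (ENNReal.ofReal_le_ofReal_iff (by positivity)).1 hint
  linarith

theorem ofReal_rpow_div_ofReal_rpow {x d P E : ℝ} (hx : 0 ≤ x) (hd : 0 ≤ d) (hxd : d = 0 → x = 0)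
    (hP : 0 < P) (hE : 0 < E) :
    ENNReal.ofReal x ^ P / ENNReal.ofReal d ^ E = ENNReal.ofReal (x ^ P / d ^ E) := by
  rcases hd.eq_or_lt with h0 | h0
  · rw [hxd h0.symm, ENNReal.ofReal_zero, ENNReal.zero_rpow_of_pos hP, ENNReal.zero_div,
      Real.zero_rpow hP.ne', _root_.zero_div, ENNReal.ofReal_zero]
  · rw [ENNReal.ofReal_div_of_pos (by positivity), ENNReal.ofReal_rpow_of_nonneg hx hP.le,
      ENNReal.ofReal_rpow_of_nonneg hd hE.le]

theorem gmodular_le_of_le {s p : RN N → RN N → ℝ} (hp0 : ∀ x y, 0 < p x y) (u : RN N → ℝ)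
    {A : Set (RN N × RN N)} {l l' : ℝ} (hl : 0 < l) (h : l ≤ l') :
    gmodular A s p u l' ≤ gmodular A s p u l := by
  refine lintegral_mono fun z => ENNReal.div_le_div_right (ENNReal.rpow_le_rpow ?_ (hp0 _ _).le) _
  refine ENNReal.ofReal_le_ofReal ?_
  gcongr

theorem gmodular_div {s p : RN N → RN N → ℝ} (u : RN N → ℝ) {A : Set (RN N × RN N)} {l : ℝ}
    (hl : 0 < l) : gmodular A s p (fun x => u x / l) 1 = gmodular A s p u l := by
  unfold gmodular
  refine lintegral_congr fun z => ?_
  rw [← sub_div, abs_div, abs_of_pos hl, div_one]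

theorem gmodular_le_mul_gmodular_one {s p : RN N → RN N → ℝ} (hp0 : ∀ x y, 0 < p x y) {P : ℝ}
    (hpP : ∀ x y, p x y ≤ P) (u : RN N → ℝ) {A : Set (RN N × RN N)} {l : ℝ} (hl : 0 < l)
    (hl1 : l ≤ 1) :
    gmodular A s p u l ≤ ENNReal.ofReal (l ^ (-P)) * gmodular A s p u 1 := by
  unfold gmodular
  rw [← lintegral_const_mul' _ _ ENNReal.ofReal_ne_top]
  refine lintegral_mono fun z => ?_
  rw [← mul_div_assoc]
  refine ENNReal.div_le_div_right ?_ _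
  have hp := hp0 z.1 z.2
  rw [div_one, ENNReal.ofReal_rpow_of_nonneg (by positivity) hp.le,
    ENNReal.ofReal_rpow_of_nonneg (by positivity) hp.le, ← ENNReal.ofReal_mul (by positivity)]
  refine ENNReal.ofReal_le_ofReal ?_
  rw [Real.div_rpow (abs_nonneg _) hl.le, div_eq_mul_inv, ← Real.rpow_neg hl.le, mul_comm]
  gcongr ?_ * _
  exact Real.rpow_le_rpow_of_exponent_ge hl hl1 (neg_le_neg (hpP _ _))

theorem exists_gmodular_lt_one {s p : RN N → RN N → ℝ} {u : RN N → ℝ} {δ l' : ℝ} (hδ : 0 < δ)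
    (hδl : δ < l') (h : x0Norm s p u = δ) : ∃ l, 0 < l ∧ l < l' ∧ gmodular univ s p u l < 1 := by
  have hne : {l | 0 < l ∧ gmodular univ s p u l < 1}.Nonempty := by
    by_contra hcon
    rw [x0Norm, not_nonempty_iff_eq_empty.1 hcon, Real.sInf_empty] at h
    linarith
  obtain ⟨l, ⟨hl0, hl⟩, hll⟩ := exists_lt_of_csInf_lt hne (h.trans_lt hδl)
  exact ⟨l, hl0, hll, hl⟩

theorem one_le_gmodular {s p : RN N → RN N → ℝ} {u : RN N → ℝ} {l : ℝ} (hl : 0 < l)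
    (h : l < x0Norm s p u) : 1 ≤ gmodular univ s p u l := by
  by_contra hcon
  have : x0Norm s p u ≤ l := csInf_le ⟨0, fun _ h => h.1.le⟩ ⟨hl, not_le.1 hcon⟩
  linarith

theorem rpow_div_le_integral_gagliardo {s p : RN N → RN N → ℝ}
    (hs : Continuous fun z : RN N × RN N => s z.1 z.2)
    (hp : Continuous fun z : RN N × RN N => p z.1 z.2)
    (hs0 : ∀ x y, 0 < s x y) (hp1 : ∀ x y, 1 < p x y) {P : ℝ} (hpP : ∀ x y, p x y ≤ P)
    {u : RN N → ℝ} (hu : Measurable u) {δ : ℝ} (hδ : 0 < δ) (hδ1 : δ < 1)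
    (h : x0Norm s p u = δ) :
    (δ / 2) ^ P / P ≤ ∫ z : RN N × RN N, |u z.1 - u z.2| ^ p z.1 z.2 /
      (p z.1 z.2 * dist z.1 z.2 ^ ((N : ℝ) + s z.1 z.2 * p z.1 z.2)) := by
  have hp0 : ∀ x y, 0 < p x y := fun x y => one_pos.trans (hp1 x y)
  have hP : 0 < P := (hp0 0 0).trans_le (hpP 0 0)
  have hfin : gmodular univ s p u 1 < ⊤ := by
    obtain ⟨l, hl0, hl1, hl⟩ := exists_gmodular_lt_one hδ hδ1 h
    exact ((gmodular_le_of_le hp0 u hl0 hl1.le).trans_lt hl).trans one_lt_top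
  have hlow := (one_le_gmodular (half_pos hδ) (by rw [h]; linarith)).trans
    (gmodular_le_mul_gmodular_one hp0 hpP u (half_pos hδ) (by linarith))
  have heq : gmodular univ s p u 1 = ∫⁻ z : RN N × RN N, ENNReal.ofReal
      (|u z.1 - u z.2| ^ p z.1 z.2 / dist z.1 z.2 ^ ((N : ℝ) + s z.1 z.2 * p z.1 z.2)) := by
    unfold gmodular
    rw [Measure.restrict_univ]
    refine lintegral_congr fun z => ?_
    rw [div_one]
    refine ofReal_rpow_div_ofReal_rpow (abs_nonneg _) dist_nonneg (fun h0 => ?_) (hp0 _ _)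
      (add_pos_of_nonneg_of_pos (Nat.cast_nonneg N) (mul_pos (hs0 _ _) (hp0 _ _)))
    rw [dist_eq_zero.1 h0, sub_self, abs_zero]
  set I : RN N × RN N → ℝ := fun z => |u z.1 - u z.2| ^ p z.1 z.2 /
      (p z.1 z.2 * dist z.1 z.2 ^ ((N : ℝ) + s z.1 z.2 * p z.1 z.2)) with hI
  have hI0 : ∀ z, 0 ≤ I z := fun z => by
    have := hp0 z.1 z.2
    positivity
  have hIm : Measurable I := by
    have h1 := hs.measurable
    have h2 := hp.measurable
    have h3 : Measurable fun z : RN N × RN N => |u z.1 - u z.2| :=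
      ((hu.comp measurable_fst).sub (hu.comp measurable_snd)).abs
    have h4 : Measurable fun z : RN N × RN N => dist z.1 z.2 := measurable_dist
    exact (h3.pow h2).div (h2.mul (h4.pow (measurable_const.add (h1.mul h2))))
  have hIeq : ∀ z, p z.1 z.2 * I z =
      |u z.1 - u z.2| ^ p z.1 z.2 / dist z.1 z.2 ^ ((N : ℝ) + s z.1 z.2 * p z.1 z.2) := by
    intro z
    have := (hp0 z.1 z.2).ne'
    rw [hI]
    field_simp
  have hIle : ∫⁻ z, ENNReal.ofReal (I z) ≤ gmodular univ s p u 1 := by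
    rw [heq]
    refine lintegral_mono fun z => ENNReal.ofReal_le_ofReal ?_
    rw [← hIeq z]
    exact le_mul_of_one_le_left (hI0 z) (hp1 _ _).le
  have hgle : gmodular univ s p u 1 ≤ ENNReal.ofReal P * ∫⁻ z, ENNReal.ofReal (I z) := by
    rw [heq, ← lintegral_const_mul' _ _ ENNReal.ofReal_ne_top]
    refine lintegral_mono fun z => ?_
    rw [← ENNReal.ofReal_mul hP.le, ← hIeq z]
    exact ENNReal.ofReal_le_ofReal (mul_le_mul_of_nonneg_right (hpP _ _) (hI0 z))
  rw [integral_eq_lintegral_of_nonneg_ae (Eventually.of_forall hI0) hIm.aestronglyMeasurable]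
  have hd : 0 < (δ / 2) ^ P := by positivity
  have hfinal := hlow.trans (mul_le_mul_right hgle _)
  rw [← ENNReal.ofReal_toReal (hIle.trans_lt hfin).ne, ← ENNReal.ofReal_mul hP.le,
    ← ENNReal.ofReal_mul (by positivity), ENNReal.one_le_ofReal, Real.rpow_neg (by positivity),
    inv_mul_eq_div, one_le_div hd] at hfinal
  rw [div_le_iff₀ hP]
  linarith

theorem abs_Fant_le {f : RN N → ℝ → ℝ} {x : RN N} {M ρ : ℝ} (hM : 0 ≤ M) (hρ : 1 < ρ)
    (hf : ∀ t : ℝ, |f x t| ≤ M * |t| ^ (ρ - 1)) (t : ℝ) : |Fant f x t| ≤ M * |t| ^ ρ := by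
  have h := intervalIntegral.norm_integral_le_of_norm_le_const (a := 0) (b := t) (f := f x)
    (C := M * |t| ^ (ρ - 1)) fun τ hτ => by
      refine (hf τ).trans ?_
      have hτt : |τ| ≤ |t| := by
        rcases mem_uIoc.1 hτ with h | h
        · rw [abs_of_pos h.1]; exact h.2.trans (le_abs_self t)
        · rw [abs_of_nonpos h.2, abs_of_nonpos (h.1.le.trans h.2)]; linarith [h.1]
      gcongr
  refine h.trans_eq ?_
  rw [sub_zero, mul_assoc]
  congr 1
  nth_rewrite 2 [← Real.rpow_one |t|]
  rw [← Real.rpow_add' (abs_nonneg t) (by linarith), sub_add_cancel]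

theorem abs_integral_rpow_div_le {Ω : Set (RN N)} (hΩo : IsOpen Ω) {α γ : RN N → ℝ}
    (hα : ∀ x ∈ Ω, 1 ≤ α x) (hαγ : ∀ x ∈ Ω, α x ≤ γ x) {u v : RN N → ℝ}
    (huv : ∀ x, |u x| ≤ |v x|) {C : ℝ≥0∞} (hC : volume Ω + C ≠ ⊤)
    (hv : ∫⁻ x in Ω, ENNReal.ofReal |v x| ^ γ x ≤ C) :
    |∫ x in Ω, |u x| ^ α x / α x| ≤ (volume Ω + C).toReal := by
  have h : ‖∫ x in Ω, |u x| ^ α x / α x‖ₑ ≤ volume Ω + C := by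
    calc ‖∫ x in Ω, |u x| ^ α x / α x‖ₑ ≤ ∫⁻ x in Ω, ‖|u x| ^ α x / α x‖ₑ :=
          enorm_integral_le_lintegral_enorm _
      _ ≤ ∫⁻ x in Ω, (1 + ENNReal.ofReal |v x| ^ γ x) := by
          refine setLIntegral_mono' hΩo.measurableSet fun x hx => ?_
          have h1 := hα x hx
          have h2 := hαγ x hx
          have h3 : ENNReal.ofReal |u x| ≤ ENNReal.ofReal |v x| := ENNReal.ofReal_le_ofReal (huv x)
          have h4 : ‖|u x| ^ α x / α x‖ₑ ≤ ENNReal.ofReal |v x| ^ α x := by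
            rw [Real.enorm_eq_ofReal_abs, abs_of_nonneg (by positivity)]
            refine le_trans ?_ (ENNReal.rpow_le_rpow h3 (by linarith))
            rw [ENNReal.ofReal_rpow_of_nonneg (abs_nonneg _) (by linarith)]
            exact ENNReal.ofReal_le_ofReal (div_le_self (by positivity) h1)
          refine h4.trans ?_
          rcases le_total (ENNReal.ofReal |v x|) 1 with h5 | h5
          · exact (ENNReal.rpow_le_one h5 (by linarith)).trans le_self_add
          · exact (ENNReal.rpow_le_rpow_of_exponent_le h5 h2).trans le_add_self
      _ = volume Ω + ∫⁻ x in Ω, ENNReal.ofReal |v x| ^ γ x := by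
          rw [lintegral_add_left measurable_const, setLIntegral_one]
      _ ≤ volume Ω + C := by gcongr
  rw [Real.enorm_eq_ofReal_abs] at h
  exact (ENNReal.ofReal_le_iff_le_toReal hC).1 h

theorem sInf_le_of_sInf_pos {A : Set ℝ} (h : 0 < sInf A) {a : ℝ} (ha : a ∈ A) : sInf A ≤ a := by
  refine csInf_le ?_ ha
  by_contra hcon
  rw [Real.sInf_of_not_bddBelow hcon] at h
  exact h.false

/-- An exponent slightly above `q⁺` that keeps the strict subcriticality in `𝓜`. -/
theorem exists_exponent [NeZero N] {Ω : Set (RN N)} (hΩb : Bornology.IsBounded Ω)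
    {s p : RN N → RN N → ℝ}
    (hs : Continuous fun z : RN N × RN N => s z.1 z.2)
    (hp : Continuous fun z : RN N × RN N => p z.1 z.2)
    (hsp : ∀ x y, s x y * p x y < N) {r : RN N → ℝ} (hr : Continuous r) (hr0 : ∀ x, 0 < r x)
    {Q : ℝ} (hQ2 : Q < 2) (hQ : ∀ x, r x * Q < pstar s p x) :
    ∃ a, Q < a ∧ a < 2 ∧ ∀ x ∈ closure Ω, r x * a < pstar s p x := by
  have hdiag : Continuous fun x : RN N => (x, x) := by fun_prop
  have hsd : Continuous fun x => s x x := hs.comp hdiag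
  have hpd : Continuous fun x => p x x := hp.comp hdiag
  have hcont : Continuous fun x => pstar s p x / r x := by
    refine Continuous.div ?_ hr fun x => (hr0 x).ne'
    exact (continuous_const.mul hpd).div (continuous_const.sub (hsd.mul hpd))
      fun x => by linarith [hsp x x]
  rcases (closure Ω).eq_empty_or_nonempty with h0 | hne
  · obtain ⟨a, ha, ha2⟩ := exists_between hQ2
    exact ⟨a, ha, ha2, by simp [h0]⟩
  obtain ⟨x₀, _, hmin⟩ := hΩb.isCompact_closure.exists_isMinOn hne hcont.continuousOn
  have hx₀ : Q < pstar s p x₀ / r x₀ := by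
    rw [lt_div_iff₀ (hr0 x₀), mul_comm]; exact hQ x₀
  obtain ⟨a, ha, ha2⟩ := exists_between (lt_min hQ2 hx₀)
  refine ⟨a, ha, ha2.trans_le (min_le_left _ _), fun x hx => ?_⟩
  have h := (ha2.trans_le (min_le_right _ _)).trans_le (isMinOn_iff.1 hmin x hx)
  rwa [lt_div_iff₀ (hr0 x), mul_comm] at h

theorem exists_small_radius {P K : ℝ} (hP : 0 < P) :
    ∃ δ : ℝ, 0 < δ ∧ δ < 1 / 2 ∧ K * δ ^ P ≤ 1 := by
  have hlim : Tendsto (fun δ : ℝ => K * δ ^ P) (nhds 0) (nhds 0) := by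
    have h := ((Real.continuousAt_rpow_const 0 P (Or.inr hP.le)).const_mul K).tendsto
    rwa [Real.zero_rpow hP.ne', MulZeroClass.mul_zero] at h
  obtain ⟨δ, ⟨h1, h2⟩, h3⟩ := ((((hlim.eventually_le_const one_pos).and
    (eventually_lt_nhds (show (0 : ℝ) < 1 / 2 by norm_num))).filter_mono nhdsWithin_le_nhds).and
      (self_mem_nhdsWithin (a := (0 : ℝ)) (s := Ioi 0))).exists
  exact ⟨δ, h3, h2, h1⟩

theorem statement18
    {N : ℕ} (hN : 2 ≤ N) (Ω : Set (RN N))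
    (hΩo : IsOpen Ω) (hΩb : Bornology.IsBounded Ω) (hΩne : Ω.Nonempty)
    (s p μ q : RN N → RN N → ℝ) (f : RN N → ℝ → ℝ) (M Θ : ℝ) (r : RN N → ℝ)
    (hs : S1 s) (hp : P1 s p) (hμ : Mu1 μ) (hq : CPlus2 q)
    (hqμ : ∀ x y, 2 / q x y + μ x y / (N : ℝ) = 2)
    (hf : Caratheodory f)
    (hr : CPlusOn univ r) (hrM : MemM s p q r) (hrp : sup2 p < infOn univ r)
    (hf1 : F1 Ω f M r) (hΘ : sup2 p < Θ) (hf2 : F2 Ω f Θ)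
    (α : RN N → ℝ) (hα : CPlusOn (closure Ω) α)
    (hαp : supOn (closure Ω) α < inf2 p) :
    ∃ Λ : ℝ, 0 < Λ ∧ ∀ lam : ℝ, 0 < lam → lam < Λ →
      ∃ ζ δ : ℝ, 0 < ζ ∧ 0 < δ ∧ δ < 1 ∧
        ∀ u : RN N → ℝ, MemX0 Ω s p (fun x => p x x) u →
          x0Norm s p u = δ → ζ ≤ Jlam Ω s p μ f α lam u := by
  have : NeZero N := ⟨by omega⟩
  have hN0 : 0 < (N : ℝ) := Nat.cast_pos.2 (NeZero.pos N)
  obtain ⟨hsc, -, hsB, hs0', -⟩ := hs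
  obtain ⟨⟨hpc, hp1', hpB⟩, -, hspN⟩ := hp
  obtain ⟨-, hμB, hμ0', hμN⟩ := hμ
  obtain ⟨-, hq1', hqB⟩ := hq
  obtain ⟨hrc, hr1', -⟩ := hr
  obtain ⟨-, hα1', hαB⟩ := hα
  obtain ⟨hM, hf1⟩ := hf1
  have hs0 : ∀ x y, 0 < s x y := fun x y =>
    hs0'.trans_le (sInf_le_of_sInf_pos hs0' ⟨x, y, rfl⟩)
  have hpI : ∀ x y, inf2 p ≤ p x y := fun x y =>
    sInf_le_of_sInf_pos (one_pos.trans hp1') ⟨x, y, rfl⟩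
  have hp1 : ∀ x y, 1 < p x y := fun x y => hp1'.trans_le (hpI x y)
  have hpP : ∀ x y, p x y ≤ sup2 p := fun x y => le_csSup hpB ⟨x, y, rfl⟩
  have hP1 : 1 < sup2 p := (hp1 0 0).trans_le (hpP 0 0)
  have hsp : ∀ x y, s x y * p x y < N := fun x y => by
    refine lt_of_le_of_lt ?_ hspN
    have h1 : s x y ≤ sup2 s := le_csSup hsB ⟨x, y, rfl⟩
    have h2 := hs0 x y
    have h3 := hp1 x y
    exact mul_le_mul h1 (hpP x y) (by linarith) (by linarith)
  have hμ0 : ∀ x y, 0 < μ x y := fun x y =>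
    hμ0'.trans_le (sInf_le_of_sInf_pos hμ0' ⟨x, y, rfl⟩)
  have hqI : ∀ x y, inf2 q ≤ q x y := fun x y =>
    sInf_le_of_sInf_pos (one_pos.trans hq1') ⟨x, y, rfl⟩
  have hqQ : ∀ x y, q x y ≤ sup2 q := fun x y => le_csSup hqB ⟨x, y, rfl⟩
  have hQ1 : 1 < sup2 q := (hq1'.trans_le (hqI 0 0)).trans_le (hqQ 0 0)
  have hQ2 : sup2 q < 2 := by
    have h1 : sup2 μ / N < 1 := (div_lt_one hN0).2 hμN
    have h2 : sup2 q ≤ 2 / (2 - sup2 μ / N) := by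
      refine csSup_le ⟨_, 0, 0, rfl⟩ ?_
      rintro _ ⟨x, y, rfl⟩
      have h3 : μ x y / N ≤ sup2 μ / N :=
        div_le_div_of_nonneg_right (le_csSup hμB ⟨x, y, rfl⟩) hN0.le
      have h4 : 0 < q x y := by linarith [hqI x y]
      rw [le_div_iff₀ (by linarith), mul_comm, ← le_div_iff₀ h4]
      linarith [hqμ x y]
    refine h2.trans_lt ?_
    rw [div_lt_iff₀ (by linarith)]
    linarith
  have hμm : ∀ x y, μ x y ≤ N * (2 - 2 / sup2 q) := fun x y => by
    have h4 : 0 < q x y := by linarith [hqI x y]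
    have h5 : 2 / sup2 q ≤ 2 / q x y := div_le_div_of_nonneg_left (by norm_num) h4 (hqQ x y)
    rw [← div_le_iff₀' hN0]
    linarith [hqμ x y]
  have hrI : ∀ x, infOn univ r ≤ r x := fun x =>
    sInf_le_of_sInf_pos (one_pos.trans hr1') ⟨x, mem_univ x, rfl⟩
  have hr1 : ∀ x, 1 < r x := fun x => hr1'.trans_le (hrI x)
  have hrP : ∀ x, sup2 p ≤ r x := fun x => hrp.le.trans (hrI x)
  have hr0 : ∀ x, 0 < r x := fun x => one_pos.trans (hr1 x)
  have hrcont : Continuous r := continuousOn_univ.1 hrc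
  obtain ⟨a, haQ, ha2, harp⟩ := exists_exponent hΩb hsc hpc hsp hrcont hr0 hQ2
    fun x => (hrM x).2.2
  have ha1 : 1 < a := hQ1.trans haQ
  obtain ⟨C, hC, hemb⟩ := exists_lintegral_rpow_le hsc hpc hs0 hp1 hsp hΩo hΩb
    (hrcont.mul_const a) (fun x => mul_pos (hr0 x) (by linarith)) harp
  obtain ⟨B, hB0, hB⟩ := exists_abs_integral_integral_le hΩo hΩb ha1 ha2.le
    (m := N * (2 - 2 / sup2 q)) (by
      have : 2 / a < 2 / sup2 q :=
        div_lt_div_of_pos_left (by norm_num) (by linarith) haQ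
      gcongr) hC
  set P := sup2 p with hP
  have hP0 : 0 < P := by linarith
  obtain ⟨δ, hδ0, hδ2, hδ⟩ := exists_small_radius (P := P)
    (K := 2 * P * B * M ^ 2 * (2 ^ P) ^ 3) hP0
  have hCV : volume Ω + C ≠ ⊤ := ENNReal.add_ne_top.2 ⟨hΩb.measure_lt_top.ne, hC⟩
  set V := (volume Ω + C).toReal with hV
  have hV0 : 0 ≤ V := ENNReal.toReal_nonneg
  set e := (δ / 2) ^ P / P with he
  have he0 : 0 < e := by positivity
  have hchoq : 1 / 2 * (B * (M * (2 * δ) ^ P) ^ 2) ≤ e / 4 := by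
    rw [he, Real.div_rpow hδ0.le (by norm_num), Real.mul_rpow (by norm_num) hδ0.le, div_div,
      div_div, le_div_iff₀ (by positivity)]
    have hδP : 0 < δ ^ P := by positivity
    calc 1 / 2 * (B * (M * (2 ^ P * δ ^ P)) ^ 2) * (2 ^ P * (P * 4))
        = 2 * P * B * M ^ 2 * (2 ^ P) ^ 3 * δ ^ P * δ ^ P := by ring
      _ ≤ 1 * δ ^ P := by gcongr
      _ = δ ^ P := _root_.one_mul _
  refine ⟨e / (4 * (V + 1)), by positivity, fun lam hlam0 hlam => ?_⟩
  refine ⟨e / 2, δ, by positivity, hδ0, by linarith, ?_⟩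
  rintro u ⟨hu, -, -, hu0⟩ hnorm
  obtain ⟨l, hl0, hlδ, hl⟩ := exists_gmodular_lt_one hδ0 (show δ < 2 * δ by linarith) hnorm
  have hl1 : l ≤ 1 := by linarith
  have hvE : gmodular univ s p (fun x => u x / l) 1 ≤ 1 := by
    rw [gmodular_div u hl0]; exact hl.le
  have hvm : Measurable fun x => u x / l := hu.div_const l
  have hv := hemb (fun x => u x / l) hvm
    (by filter_upwards [hu0] with x hx hxΩ; rw [hx hxΩ, _root_.zero_div]) hvE
  have huv : ∀ x, |u x| = l * |u x / l| := fun x => by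
    rw [abs_div, abs_of_pos hl0]; field_simp
  have henergy := rpow_div_le_integral_gagliardo hsc hpc hs0 hp1 hpP hu hδ0 (by linarith) hnorm
  have hαint := abs_integral_rpow_div_le hΩo (α := α) (γ := fun x => r x * a)
    (fun x hx => hα1'.le.trans
      (sInf_le_of_sInf_pos (one_pos.trans hα1') ⟨x, subset_closure hx, rfl⟩))
    (fun x hx => by
      have h1 : α x ≤ supOn (closure Ω) α := le_csSup hαB ⟨x, subset_closure hx, rfl⟩
      have h2 : r x * inf2 q ≤ r x * a :=
        mul_le_mul_of_nonneg_left (((hqI 0 0).trans (hqQ 0 0)).trans haQ.le) (hr0 x).le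
      linarith [hpI x x, (hrM x).1])
    (u := u) (v := fun x => u x / l)
    (fun x => (huv x).trans_le (mul_le_of_le_one_left (abs_nonneg _) hl1)) hCV hv
  have hF := hB μ hμ0 hμm (fun x => Fant f x (u x)) (fun x => |u x / l| ^ r x)
    (M * (2 * δ) ^ P) (hvm.abs.pow hrcont.measurable) (fun x => by positivity) (by positivity)
    (fun x hx => by
      refine (abs_Fant_le hM.le (hr1 x) (hf1 x hx) (u x)).trans ?_
      rw [huv x, Real.mul_rpow hl0.le (abs_nonneg _), mul_assoc]
      gcongr
      calc l ^ r x ≤ l ^ P := Real.rpow_le_rpow_of_exponent_ge hl0 hl1 (hrP x)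
        _ ≤ (2 * δ) ^ P := by gcongr)
    (by
      refine le_trans (le_of_eq (lintegral_congr fun x => ?_)) hv
      have := hr0 x
      rw [← Real.rpow_mul (abs_nonneg _), ENNReal.ofReal_rpow_of_nonneg (abs_nonneg _)
        (by positivity)])
  have hlamV : lam * (∫ x in Ω, |u x| ^ α x / α x) ≤ e / 4 := by
    calc lam * (∫ x in Ω, |u x| ^ α x / α x) ≤ lam * V := by
          gcongr
          exact (le_abs_self _).trans hαint
      _ ≤ e / (4 * (V + 1)) * (V + 1) := by gcongr; linarith
      _ = e / 4 := by field_simp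
  have hF' := (le_abs_self _).trans hF
  unfold Jlam Jfun
  linarith

end VarOrderChoquard
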